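/- If A = (V, E_R, E_W) is an annotation DAG reachable from A_init = ({⊥}, ∅, ∅) by a nonempty finite sequence of forward annotation transitions, and the last transition of that sequence has label (p, Rd, Wt), then a backward transition with label (p, Rd, Wt) is enabled at A; moreover the node removed by this backward transition is v = (p, max_p(V)), v has no outgoing edge in E_R ∪ E_W, and every incoming edge (v', r, v) ∈ E_R ∪ E_W satisfies v' = last(r, E_W) unless r ∈ Wt. -/

import Mathlib

namespace CRIL

/-- Process identifiers: finite lists of positive integers. -/
abbrev PID := List ℕ+

/-- Nodes of an annotation DAG: either ⊥ or a pair (p, n). -/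
inductive ANode where
  | bot : ANode
  | node : PID → ℕ → ANode
deriving DecidableEq

/-- Labeled edges. -/
abbrev AEdge (R : Type) := ANode × R × ANode

/-- Annotation DAGs, with the five defining conditions. -/
structure AnnDAG (R : Type) where
  V : Set ANode
  ER : Set (AEdge R)
  EW : Set (AEdge R)
  finV : V.Finite
  bot_mem : ANode.bot ∈ V
  down : ∀ p n, ANode.node p n ∈ V → ∀ n' ≤ n, ANode.node p n' ∈ V
  edges_sub : ∀ e ∈ ER ∪ EW, e.1 ∈ V ∧ e.2.2 ∈ V
  in_unique : ∀ v' v'' r v, (v', r, v) ∈ ER ∪ EW → (v'', r, v) ∈ ER ∪ EW → v' = v''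
  disj : ER ∩ EW = ∅
  acyclic : ∀ v, ¬ Relation.TransGen (fun a b => ∃ r, (a, r, b) ∈ ER ∪ EW) v v
  w_pred : ∀ v' r v, (v', r, v) ∈ EW → v' ≠ ANode.bot → ∃ v'', (v'', r, v') ∈ EW
  w_out_unique : ∀ v r v' v'', (v, r, v') ∈ EW → (v, r, v'') ∈ EW → v' = v''

-- `last(r, E_W)`: the final node of the unique maximal chain of `r`-labeled
-- `E_W`-edges starting at ⊥ (⊥ if there is no such edge).
open Classical in
noncomputable def lastN {R : Type} (EW : Set (AEdge R)) (r : R) : ANode :=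
  if h : ∃! v, Relation.ReflTransGen (fun a b => (a, r, b) ∈ EW) ANode.bot v ∧
      ∀ w, (v, r, w) ∉ EW
  then h.exists.choose
  else ANode.bot

/-- `max_p(V) + 1`: one plus the largest `n` with `(p,n) ∈ V` (0 if none). -/
noncomputable def maxpSucc (V : Set ANode) (p : PID) : ℕ :=
  sSup {m : ℕ | ∃ n, m = n + 1 ∧ ANode.node p n ∈ V}

/-- `max_p(V)` as an integer, −1 if no `(p,n) ∈ V`. -/
noncomputable def maxp (V : Set ANode) (p : PID) : ℤ :=
  (maxpSucc V p : ℤ) - 1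

/-- Labels (p, Rd, Wt). -/
abbrev Label (R : Type) := PID × Set R × Set R

/-- Forward annotation transition A₁ ⇀(p,Rd,Wt) A₂. -/
def Step {R : Type} (A₁ A₂ : AnnDAG R) (p : PID) (Rd Wt : Set R) : Prop :=
  A₂.V = A₁.V ∪ {ANode.node p (maxpSucc A₁.V p)} ∧
  A₂.ER = A₁.ER ∪
    {e | ∃ r ∈ Rd \ Wt, e = (lastN A₁.EW r, r, ANode.node p (maxpSucc A₁.V p))} ∧
  A₂.EW = A₁.EW ∪
    {e | ∃ r ∈ Wt, e = (lastN A₁.EW r, r, ANode.node p (maxpSucc A₁.V p))}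

/-- Forward transition with some label. -/
def StepAny {R : Type} (A₁ A₂ : AnnDAG R) : Prop := ∃ p Rd Wt, Step A₁ A₂ p Rd Wt

/-- Forward transition with some label in `O`. -/
def StepIn {R : Type} (O : Set (Label R)) (A₁ A₂ : AnnDAG R) : Prop :=
  ∃ l ∈ O, Step A₁ A₂ l.1 l.2.1 l.2.2

/-- The initial annotation DAG ({⊥}, ∅, ∅). -/
def Ainit (R : Type) : AnnDAG R where
  V := {ANode.bot}
  ER := ∅
  EW := ∅
  finV := Set.finite_singleton _
  bot_mem := rfl
  down := by intro p n h; simp at h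
  edges_sub := by intro e he; simp at he
  in_unique := by intro v' v'' r v h; simp at h
  disj := by simp
  acyclic := by
    intro v h
    have hne : ∀ a b : ANode, ¬ ∃ r : R, (a, r, b) ∈ (∅ ∪ ∅ : Set (AEdge R)) := by simp
    cases h with
    | single h' => exact hne _ _ h'
    | tail _ h' => exact hne _ _ h'
  w_pred := by intro v' r v h; simp at h
  w_out_unique := by intro v r v' v'' h; simp at h

/-- Signed labels: forward or underlined (backward). -/
inductive SLabel (R : Type) where
  | fwd : Label R → SLabel R
  | bwd : Label R → SLabel R

/-- `und`: forget the underline. -/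
def und {R : Type} : SLabel R → Label R
  | .fwd a => a
  | .bwd a => a

/-- The underline-toggle. -/
def toggle {R : Type} : SLabel R → SLabel R
  | .fwd a => .bwd a
  | .bwd a => .fwd a

/-- Combined transitions: forward, or reversed forward. -/
def CStep {R : Type} (A A' : AnnDAG R) : SLabel R → Prop
  | .fwd a => Step A A' a.1 a.2.1 a.2.2
  | .bwd a => Step A' A a.1 a.2.1 a.2.2

/-- Independence of signed labels: incomparable pids and disjoint read/write sets. -/
def indepLab {R : Type} (α β : SLabel R) : Prop :=
  ¬ (und α).1 <+: (und β).1 ∧ ¬ (und β).1 <+: (und α).1 ∧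
  (und α).2.1 ∩ (und β).2.2 = ∅ ∧ (und β).2.1 ∩ (und α).2.2 = ∅

/-- `diff` of a combined transition. -/
def diff {R : Type} (A A' : AnnDAG R) (α : SLabel R) :
    Set ANode × Set (AEdge R) × Set (AEdge R) :=
  match α with
  | .fwd _ => (A'.V \ A.V, A'.ER \ A.ER, A'.EW \ A.EW)
  | .bwd _ => (A.V \ A'.V, A.ER \ A'.ER, A.EW \ A'.EW)

/-- The underlying triple of an annotation DAG. -/
def triple {R : Type} (A : AnnDAG R) : Set ANode × Set (AEdge R) × Set (AEdge R) :=
  (A.V, A.ER, A.EW)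

/-- The ⊙^α operation on triples. -/
def odot {R : Type} (α : SLabel R)
    (T Δ : Set ANode × Set (AEdge R) × Set (AEdge R)) :
    Set ANode × Set (AEdge R) × Set (AEdge R) :=
  match α with
  | .fwd _ => (T.1 ∪ Δ.1, T.2.1 ∪ Δ.2.1, T.2.2 ∪ Δ.2.2)
  | .bwd _ => (T.1 \ Δ.1, T.2.1 \ Δ.2.1, T.2.2 \ Δ.2.2)


theorem lt_maxpSucc {V : Set ANode} (hV : V.Finite) {p : PID} {n : ℕ}
    (hn : ANode.node p n ∈ V) : n < maxpSucc V p := by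
  have hfin : {n : ℕ | ANode.node p n ∈ V}.Finite :=
    hV.preimage fun a _ b _ hab => by simpa using hab
  refine Nat.lt_of_succ_le (le_csSup ?_ ⟨n, rfl, hn⟩)
  refine ((hfin.image Nat.succ).subset ?_).bddAbove
  rintro m ⟨k, rfl, hk⟩
  exact ⟨k, hk, rfl⟩

theorem node_maxpSucc_notMem {V : Set ANode} (hV : V.Finite) (p : PID) :
    ANode.node p (maxpSucc V p) ∉ V :=
  fun h => (lt_maxpSucc hV h).false

theorem maxpSucc_union_node {V : Set ANode} (hV : V.Finite) (p : PID) :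
    maxpSucc (V ∪ {ANode.node p (maxpSucc V p)}) p = maxpSucc V p + 1 := by
  refine IsGreatest.csSup_eq ⟨⟨_, rfl, Or.inr rfl⟩, ?_⟩
  rintro m ⟨k, rfl, hk | hk⟩
  · have := lt_maxpSucc hV hk
    omega
  · simp only [Set.mem_singleton_iff, ANode.node.injEq, true_and] at hk
    omega

theorem lastN_congr {R : Type} {E E' : Set (AEdge R)} {r : R}
    (h : ∀ a b, (a, r, b) ∈ E ↔ (a, r, b) ∈ E') : lastN E r = lastN E' r := by
  classical
  have key : ∀ P Q : ANode → Prop, P = Q →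
      (if h : ∃! v, P v then h.exists.choose else ANode.bot) =
        if h : ∃! v, Q v then h.exists.choose else ANode.bot := by
    rintro P _ rfl
    rfl
  unfold lastN
  convert key (fun v => Relation.ReflTransGen (fun a b => (a, r, b) ∈ E) ANode.bot v ∧
    ∀ w, (v, r, w) ∉ E) (fun v => Relation.ReflTransGen (fun a b => (a, r, b) ∈ E') ANode.bot v ∧
    ∀ w, (v, r, w) ∉ E') (by simp only [h])

theorem AnnDAG.no_self_loop {R : Type} (A : AnnDAG R) (v : ANode) (r : R) :
    (v, r, v) ∉ A.ER ∪ A.EW :=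
  fun h => A.acyclic v (.single ⟨r, h⟩)

namespace Step

variable {R : Type} {A₁ A₂ : AnnDAG R} {p : PID} {Rd Wt : Set R}

theorem maxpSucc_eq (h : Step A₁ A₂ p Rd Wt) : maxpSucc A₂.V p = maxpSucc A₁.V p + 1 := by
  rw [h.1, maxpSucc_union_node A₁.finV]

theorem mem_edges (h : Step A₁ A₂ p Rd Wt) {e : AEdge R} (he : e ∈ A₂.ER ∪ A₂.EW) :
    e ∈ A₁.ER ∪ A₁.EW ∨
      ∃ r ∈ Rd ∪ Wt, e = (lastN A₁.EW r, r, ANode.node p (maxpSucc A₁.V p)) := by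
  rw [h.2.1, h.2.2] at he
  rcases he with (he | ⟨r, hr, rfl⟩) | (he | ⟨r, hr, rfl⟩)
  · exact .inl (.inl he)
  · exact .inr ⟨r, .inl hr.1, rfl⟩
  · exact .inl (.inr he)
  · exact .inr ⟨r, .inr hr, rfl⟩

theorem no_outgoing (h : Step A₁ A₂ p Rd Wt) (r : R) (w : ANode) :
    (ANode.node p (maxpSucc A₁.V p), r, w) ∉ A₂.ER ∪ A₂.EW := by
  intro he
  rcases h.mem_edges he with h₁ | ⟨r', -, heq⟩
  · exact node_maxpSucc_notMem A₁.finV p (A₁.edges_sub _ h₁).1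
  · simp only [Prod.mk.injEq] at heq
    rw [heq.2.2] at he
    exact A₂.no_self_loop _ _ he

theorem eq_lastN_of_incoming (h : Step A₁ A₂ p Rd Wt) {v' : ANode} {r : R}
    (he : (v', r, ANode.node p (maxpSucc A₁.V p)) ∈ A₂.ER ∪ A₂.EW) :
    v' = lastN A₁.EW r := by
  rcases h.mem_edges he with h₁ | ⟨r', -, heq⟩
  · exact absurd (A₁.edges_sub _ h₁).2 (node_maxpSucc_notMem A₁.finV p)
  · simp only [Prod.mk.injEq] at heq
    rw [heq.1, heq.2.1]

theorem lastN_eq (h : Step A₁ A₂ p Rd Wt) {r : R} (hr : r ∉ Wt) :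
    lastN A₂.EW r = lastN A₁.EW r := by
  refine lastN_congr fun a b => ?_
  rw [h.2.2]
  refine or_iff_left ?_
  rintro ⟨r', hr', heq⟩
  simp only [Prod.mk.injEq] at heq
  exact hr (heq.2.1 ▸ hr')

end Step

/-- if `A` is reached from `Ainit` by a nonempty forward sequence whose
last transition has label (p, Rd, Wt), then the backward transition with that label
is enabled at `A`; the removed node `v = (p, max_p(V))` has no outgoing edge, and
every incoming edge `(v', r, v)` with `r ∉ Wt` satisfies `v' = last(r, E_W)`. -/
theorem stmt15 {R : Type} (A A₀ : AnnDAG R) (p : PID) (Rd Wt : Set R)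
    (h0 : Relation.ReflTransGen (StepAny (R := R)) (Ainit R) A₀)
    (hlast : Step A₀ A p Rd Wt) :
    (∃ A' : AnnDAG R, Step A' A p Rd Wt) ∧
    (ANode.node p (maxpSucc A.V p - 1) ∉ A₀.V ∧
      A.V = A₀.V ∪ {ANode.node p (maxpSucc A.V p - 1)}) ∧
    (∀ r w, (ANode.node p (maxpSucc A.V p - 1), r, w) ∉ A.ER ∪ A.EW) ∧
    (∀ v' r, (v', r, ANode.node p (maxpSucc A.V p - 1)) ∈ A.ER ∪ A.EW →
      r ∉ Wt → v' = lastN A.EW r) := by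
  have hmax : maxpSucc A.V p - 1 = maxpSucc A₀.V p := by
    rw [hlast.maxpSucc_eq, Nat.add_sub_cancel]
  rw [hmax]
  exact ⟨⟨A₀, hlast⟩, ⟨node_maxpSucc_notMem A₀.finV p, hlast.1⟩, hlast.no_outgoing,
    fun v' r he hr => (hlast.eq_lastN_of_incoming he).trans (hlast.lastN_eq hr).symm⟩

end CRIL
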